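/- arXiv:1908.06542 — 3 statements merged into one kernel-verified Lean document; each statement's English description precedes it below -/
import Mathlib

section
/- Let k be a field of characteristic zero and (R, Δ) a commutative differential k-algebra with R noetherian and dim_k R < |k|. Then for any Δ-prime ideal P of R: if {P} is locally closed in Δ-spec R then P is Δ-primitive, and if P is Δ-primitive then P is Δ-rational. -/
universe u

section DifferentialAlgebra

variable (k R : Type u) [Field k] [CommRing R] [Algebra k R]

/-- `I` is a `Δ`-ideal: it is stable under every derivation in `Δ`. -/
def IsDeltaIdeal (Δ : Set (Derivation k R R)) (I : Ideal R) : Prop :=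
  ∀ δ ∈ Δ, ∀ x ∈ I, δ x ∈ I

/-- `P` is a `Δ`-prime ideal: a prime ideal which is a `Δ`-ideal. -/
def IsDeltaPrime (Δ : Set (Derivation k R R)) (P : Ideal R) : Prop :=
  P.IsPrime ∧ IsDeltaIdeal k R Δ P

/-- The `Δ`-core of an ideal `J`: the largest `Δ`-ideal contained in `J`. -/
def deltaCore (Δ : Set (Derivation k R R)) (J : Ideal R) : Ideal R :=
  sSup {I : Ideal R | IsDeltaIdeal k R Δ I ∧ I ≤ J}

/-- `P` is `Δ`-primitive: it is the `Δ`-core of some maximal ideal. -/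
def IsDeltaPrimitive (Δ : Set (Derivation k R R)) (P : Ideal R) : Prop :=
  ∃ M : Ideal R, M.IsMaximal ∧ deltaCore k R Δ M = P

/-- `Δ`-spec `R`: the set of `Δ`-prime ideals, topologized as a subspace of `Spec R`. -/
abbrev DeltaSpec (Δ : Set (Derivation k R R)) : Type u :=
  {P : PrimeSpectrum R // IsDeltaIdeal k R Δ P.asIdeal}

/-- `P` is `Δ`-rational: whenever `a, b ∈ R` with `b ∉ P` are such that the class of `a/b` in
`Frac(R/P)` is killed by all the induced derivations, that class is algebraic over `k`. -/
def IsDeltaRational (Δ : Set (Derivation k R R)) (P : Ideal R) (hP : P.IsPrime) : Prop :=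
  haveI := hP
  ∀ a b : R, b ∉ P → (∀ δ ∈ Δ, δ a * b - a * δ b ∈ P) →
    IsAlgebraic k
      (algebraMap (R ⧸ P) (FractionRing (R ⧸ P)) (Ideal.Quotient.mk P a) /
       algebraMap (R ⧸ P) (FractionRing (R ⧸ P)) (Ideal.Quotient.mk P b))

/-- `P` is `κ`-separable in `Δ`-spec `R`: there is a set `Λ`, of cardinality `< κ`, of `Δ`-prime
ideals properly containing `P`, such that every `Δ`-prime ideal properly containing `P` contains
a member of `Λ`. -/
def DeltaSeparable (Δ : Set (Derivation k R R)) (κ : Cardinal.{u}) (P : Ideal R) : Prop :=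
  ∃ Λ : Set (Ideal R), (∀ Q ∈ Λ, IsDeltaPrime k R Δ Q ∧ P < Q) ∧
    Cardinal.mk Λ < κ ∧
    ∀ Q : Ideal R, IsDeltaPrime k R Δ Q → P < Q → ∃ Q' ∈ Λ, Q' ≤ Q

/-- `R` satisfies the `Δ`-Dixmier–Moeglin equivalence: for every `Δ`-prime ideal `P`, the
conditions "`{P}` is locally closed in `Δ`-spec `R`", "`P` is `Δ`-primitive", and
"`P` is `Δ`-rational" are equivalent. -/
def DeltaDME (Δ : Set (Derivation k R R)) : Prop :=
  ∀ (P : PrimeSpectrum R) (hP : IsDeltaIdeal k R Δ P.asIdeal),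
    (IsLocallyClosed ({⟨P, hP⟩} : Set (DeltaSpec k R Δ)) ↔ IsDeltaPrimitive k R Δ P.asIdeal) ∧
    (IsDeltaPrimitive k R Δ P.asIdeal ↔ IsDeltaRational k R Δ P.asIdeal P.isPrime)

end DifferentialAlgebra

open Polynomial

section DeltaIdeals

variable {k R : Type u} [Field k] [CommRing R] [Algebra k R]

/-- The iterated Leibniz rule. -/
theorem Derivation.iterate_apply_mul (δ : Derivation k R R) (n : ℕ) (a b : R) :
    δ^[n] (a * b) =
      ∑ ij ∈ Finset.HasAntidiagonal.antidiagonal n, n.choose ij.1 • (δ^[ij.1] a * δ^[ij.2] b) := by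
  induction n with
  | zero => simp
  | succ n ih =>
    rw [Finset.sum_antidiagonal_choose_succ_nsmul (fun i j => δ^[i] a * δ^[j] b),
      Function.iterate_succ_apply', ih, map_sum, ← Finset.sum_add_distrib]
    refine Finset.sum_congr rfl fun ij hij => ?_
    rw [← Nat.choose_symm_of_eq_add (Finset.HasAntidiagonal.mem_antidiagonal.1 hij).symm,
      map_nsmul, Derivation.leibniz, ← nsmul_add, Function.iterate_succ_apply',
      Function.iterate_succ_apply']
    simp only [smul_eq_mul]
    congr 2
    ring

/-- The largest ideal contained in `Q` and stable under `δ`. -/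
def Derivation.iterateCore (δ : Derivation k R R) (Q : Ideal R) : Ideal R where
  carrier := {r | ∀ n, δ^[n] r ∈ Q}
  zero_mem' n := by simp
  add_mem' {a b} ha hb n := by
    rw [iterate_map_add]
    exact Q.add_mem (ha n) (hb n)
  smul_mem' c x hx n := by
    rw [smul_eq_mul, Derivation.iterate_apply_mul]
    exact Q.sum_mem fun ij _ => nsmul_mem (Q.mul_mem_left _ (hx _)) _

theorem Ideal.mem_of_nsmul_mem [CharZero k] (Q : Ideal R) {n : ℕ} (hn : n ≠ 0) {x : R}
    (h : n • x ∈ Q) : x ∈ Q := by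
  have hx : x = algebraMap k R (n : k)⁻¹ * (n • x) := by
    rw [nsmul_eq_mul, ← map_natCast (algebraMap k R), ← mul_assoc, ← map_mul,
      inv_mul_cancel₀ (Nat.cast_ne_zero.2 hn), map_one, one_mul]
  rw [hx]
  exact Q.mul_mem_left _ h

theorem Derivation.iterateCore_isPrime [CharZero k] (δ : Derivation k R R) (Q : Ideal R)
    [hQ : Q.IsPrime] : (δ.iterateCore Q).IsPrime := by
  classical
  refine ⟨fun h => hQ.ne_top ((Ideal.eq_top_iff_one _).2
    (((Ideal.eq_top_iff_one _).1 h : (1 : R) ∈ δ.iterateCore Q) 0)), ?_⟩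
  intro a b hab
  by_contra! hcon
  obtain ⟨ha, hb⟩ := hcon
  have ha' : ∃ n, δ^[n] a ∉ Q := not_forall.1 ha
  have hb' : ∃ n, δ^[n] b ∉ Q := not_forall.1 hb
  set m := Nat.find ha'
  set n := Nat.find hb'
  have hsum := hab (m + n)
  rw [Derivation.iterate_apply_mul, ← Finset.add_sum_erase _ _
    (Finset.HasAntidiagonal.mem_antidiagonal.2 (rfl : (m, n).1 + (m, n).2 = m + n))] at hsum
  have hrest : ∑ ij ∈ (Finset.HasAntidiagonal.antidiagonal (m + n)).erase (m, n),
      (m + n).choose ij.1 • (δ^[ij.1] a * δ^[ij.2] b) ∈ Q := by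
    refine Q.sum_mem fun ij hij => nsmul_mem ?_ _
    obtain ⟨hne, hij⟩ := Finset.mem_erase.1 hij
    rw [Finset.HasAntidiagonal.mem_antidiagonal] at hij
    rcases lt_or_ge ij.1 m with h | h
    · exact Q.mul_mem_right _ (not_not.1 (Nat.find_min ha' h))
    · have h2 : ij.2 < n := by
        refine lt_of_not_ge fun h2 => hne (Prod.ext ?_ ?_) <;> simp only <;> omega
      exact Q.mul_mem_left _ (not_not.1 (Nat.find_min hb' h2))
  have hmem := Ideal.mem_of_nsmul_mem (k := k) Q
    (Nat.choose_pos (Nat.le_add_right m n)).ne' ((Q.add_mem_iff_left hrest).1 hsum)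
  exact (hQ.mem_or_mem hmem).elim (Nat.find_spec ha') (Nat.find_spec hb')

variable {Δ : Set (Derivation k R R)}

theorem IsDeltaIdeal.of_mem_minimalPrimes [CharZero k] {I Q : Ideal R}
    (hI : IsDeltaIdeal k R Δ I) (hQ : Q ∈ I.minimalPrimes) : IsDeltaIdeal k R Δ Q := by
  intro δ hδ x hx
  have := hQ.1.1
  have hle : Q ≤ δ.iterateCore Q := by
    refine hQ.2 ⟨δ.iterateCore_isPrime Q, fun y hy n => hQ.1.2 ?_⟩ fun y hy => hy 0
    induction n with
    | zero => exact hy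
    | succ n ih =>
      rw [Function.iterate_succ_apply']
      exact hI δ hδ _ ih
  exact hle hx 1

theorem isDeltaIdeal_deltaCore (J : Ideal R) : IsDeltaIdeal k R Δ (deltaCore k R Δ J) := by
  intro δ hδ
  let C : Ideal R :=
    { carrier := {x | x ∈ deltaCore k R Δ J ∧ δ x ∈ deltaCore k R Δ J}
      zero_mem' := by simp
      add_mem' := fun ha hb => ⟨add_mem ha.1 hb.1, by rw [map_add]; exact add_mem ha.2 hb.2⟩
      smul_mem' := fun c x hx => ⟨Ideal.mul_mem_left _ _ hx.1, by
        rw [smul_eq_mul, Derivation.leibniz]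
        exact add_mem (Ideal.mul_mem_left _ _ hx.2) (Ideal.mul_mem_right _ _ hx.1)⟩ }
  have hle : deltaCore k R Δ J ≤ C := sSup_le fun I hI x hx =>
    ⟨le_sSup hI hx, le_sSup hI (hI.1 δ hδ x hx)⟩
  exact fun x hx => (hle hx).2

theorem deltaCore_le (J : Ideal R) : deltaCore k R Δ J ≤ J := sSup_le fun _ hI => hI.2

theorem IsDeltaIdeal.le_deltaCore {I J : Ideal R} (hI : IsDeltaIdeal k R Δ I) (h : I ≤ J) :
    I ≤ deltaCore k R Δ J := le_sSup ⟨hI, h⟩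

theorem deltaCore_isPrime [CharZero k] (J : Ideal R) [J.IsPrime] :
    (deltaCore k R Δ J).IsPrime := by
  obtain ⟨Q, hQ, hQJ⟩ := Ideal.exists_minimalPrimes_le (deltaCore_le (Δ := Δ) (k := k) J)
  have hle := ((isDeltaIdeal_deltaCore J).of_mem_minimalPrimes hQ).le_deltaCore hQJ
  rw [le_antisymm hQ.1.2 hle]
  exact hQ.1.1

theorem exists_separating_of_isLocallyClosed {P : PrimeSpectrum R}
    {hP : IsDeltaIdeal k R Δ P.asIdeal}
    (h : IsLocallyClosed ({⟨P, hP⟩} : Set (DeltaSpec k R Δ))) :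
    ∃ f ∉ P.asIdeal, ∀ Q : Ideal R, IsDeltaPrime k R Δ Q → P.asIdeal ≤ Q → f ∉ Q →
      Q = P.asIdeal := by
  obtain ⟨U, Z, hU, hZ, hUZ⟩ := h
  obtain ⟨V, hV, rfl⟩ := isOpen_induced_iff.1 hU
  have hmem : (⟨P, hP⟩ : DeltaSpec k R Δ) ∈ Subtype.val ⁻¹' V ∩ Z := hUZ ▸ rfl
  obtain ⟨_, ⟨f, rfl⟩, hfP, hfV⟩ :=
    PrimeSpectrum.isTopologicalBasis_basic_opens.exists_subset_of_mem_open hmem.1 hV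
  refine ⟨f, hfP, fun Q hQ hPQ hfQ => ?_⟩
  let q : DeltaSpec k R Δ := ⟨⟨Q, hQ.1⟩, hQ.2⟩
  have hspec : (⟨P, hP⟩ : DeltaSpec k R Δ) ⤳ q :=
    (subtype_specializes_iff _ _).2 ((PrimeSpectrum.le_iff_specializes _ _).1 hPQ)
  have hq : q ∈ ({⟨P, hP⟩} : Set (DeltaSpec k R Δ)) := by
    rw [hUZ]
    exact ⟨hfV hfQ, hspec.mem_closed hZ hmem.2⟩
  exact congrArg (fun x : DeltaSpec k R Δ => x.1.asIdeal) hq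

end DeltaIdeals

section SmallDimension

variable {k : Type u} [Field k]

/-- If `c` is transcendental, a subspace containing all `(c - l)⁻¹` has dimension at least `|k|`. -/
theorem isAlgebraic_of_forall_sub_inv_mem_range {A K : Type u} [CommRing A] [Algebra k A]
    [Field K] [Algebra k K] (hA : Module.rank k A < Cardinal.mk k) (f : A →ₗ[k] K) (c : K)
    (h : ∀ l : k, (c - algebraMap k K l)⁻¹ ∈ LinearMap.range f) : IsAlgebraic k c := by
  by_contra hc
  have hli : LinearIndependent k fun l : k => (⟨_, h l⟩ : LinearMap.range f) :=
    LinearIndependent.of_comp (LinearMap.range f).subtype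
      (Transcendental.linearIndependent_sub_inv hc)
  exact (hli.cardinal_le_rank.trans (rank_range_le f)).not_gt hA

theorem exists_isMaximal_notMem {A : Type u} [CommRing A] [IsDomain A] [Algebra k A]
    (hA : Module.rank k A < Cardinal.mk k) {a : A} (ha : a ≠ 0) :
    ∃ M : Ideal A, M.IsMaximal ∧ a ∉ M := by
  by_contra! hcon
  have hunit (y : A) : IsUnit (a * y + 1) :=
    Ideal.mem_jacobson_bot.1 (Ideal.mem_sInf.2 fun {M} hM => hcon M hM.2) y
  let K := FractionRing A
  have haK : algebraMap A K a ≠ 0 := by simpa using ha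
  have halg : IsAlgebraic k (algebraMap A K a)⁻¹ := by
    refine isAlgebraic_of_forall_sub_inv_mem_range hA
      (IsScalarTower.toAlgHom k A K).toLinearMap _ fun l => ?_
    obtain ⟨v, hv⟩ := (hunit (-algebraMap k A l)).exists_right_inv
    refine ⟨a * v, ?_⟩
    have hv' := congrArg (algebraMap A K) hv
    simp only [map_mul, map_add, map_one, map_neg, ← IsScalarTower.algebraMap_apply] at hv'
    refine eq_inv_of_mul_eq_one_left ?_
    simp only [AlgHom.toLinearMap_apply, IsScalarTower.coe_toAlgHom', map_mul]
    linear_combination hv' + algebraMap A K v * mul_inv_cancel₀ haK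
  have hint : IsAlgebraic k a :=
    (isAlgebraic_algebraMap_iff (IsFractionRing.injective A K)).1 (IsAlgebraic.inv_iff.1 halg)
  obtain ⟨M, hM⟩ := Ideal.exists_maximal A
  have hau : IsUnit a := IsArtinianRing.isUnit_of_isIntegral_of_nonZeroDivisor hint.isIntegral
    (mem_nonZeroDivisors_of_ne_zero ha)
  exact hM.ne_top (Ideal.eq_top_of_isUnit_mem _ (hcon M hM) hau)

end SmallDimension

section Constants

variable {k R : Type u} [Field k] [CommRing R] [Algebra k R]

variable (K : Type u) [Field K] [Algebra R K] [Algebra k K] [IsScalarTower k R K]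

/-- The subalgebra of those elements of `K` which can be written `a / b` with `a b : R` and are
killed by `Δ`, by the quotient rule. -/
def deltaConstants (Δ : Set (Derivation k R R)) : Subalgebra k K where
  carrier := {u | ∃ a b : R, algebraMap R K b ≠ 0 ∧ u = algebraMap R K a / algebraMap R K b ∧
    ∀ δ ∈ Δ, algebraMap R K (δ a) * algebraMap R K b = algebraMap R K a * algebraMap R K (δ b)}
  algebraMap_mem' l := ⟨algebraMap k R l, 1, by simp, by
    simp [← IsScalarTower.algebraMap_apply], fun δ _ => by simp⟩
  add_mem' := by
    rintro _ _ ⟨a, b, hb, rfl, h⟩ ⟨a', b', hb', rfl, h'⟩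
    refine ⟨a * b' + a' * b, b * b', by simp [hb, hb'], ?_, fun δ hδ => ?_⟩
    · simp only [map_mul, map_add]
      field_simp
    · simp only [map_mul, map_add, Derivation.leibniz, smul_eq_mul]
      linear_combination (algebraMap R K b') ^ 2 * h δ hδ + (algebraMap R K b) ^ 2 * h' δ hδ
  mul_mem' := by
    rintro _ _ ⟨a, b, hb, rfl, h⟩ ⟨a', b', hb', rfl, h'⟩
    refine ⟨a * a', b * b', by simp [hb, hb'], ?_, fun δ hδ => ?_⟩
    · simp only [map_mul]
      field_simp
    · simp only [map_mul, map_add, Derivation.leibniz, smul_eq_mul]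
      linear_combination (algebraMap R K a' * algebraMap R K b') * h δ hδ +
        (algebraMap R K a * algebraMap R K b) * h' δ hδ

variable {K} {Δ : Set (Derivation k R R)}

theorem mul_algebraMap_derivation_eq {u : K} (hu : u ∈ deltaConstants K Δ)
    (hker : IsDeltaIdeal k R Δ (RingHom.ker (algebraMap R K))) {r t : R}
    (h : u * algebraMap R K r = algebraMap R K t) {δ : Derivation k R R} (hδ : δ ∈ Δ) :
    u * algebraMap R K (δ r) = algebraMap R K (δ t) := by
  obtain ⟨a, b, hb, rfl, hab⟩ := hu
  have h1 : algebraMap R K a * algebraMap R K r = algebraMap R K b * algebraMap R K t := by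
    field_simp at h
    exact h
  have h2 := hker δ hδ (a * r - b * t) (by simp [RingHom.mem_ker, h1])
  simp only [RingHom.mem_ker, map_sub, map_add, Derivation.leibniz, smul_eq_mul, map_mul] at h2
  field_simp
  refine mul_left_cancel₀ hb ?_
  linear_combination algebraMap R K b * h2 - algebraMap R K r * hab δ hδ -
    algebraMap R K (δ b) * h1

/-- The elements `r` of `R` such that `u * r` lies in the image of `R`. -/
def denominatorIdeal (R : Type u) [CommRing R] [Algebra R K] (u : K) : Ideal R where
  carrier := {r | ∃ t, u * algebraMap R K r = algebraMap R K t}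
  zero_mem' := ⟨0, by simp⟩
  add_mem' := fun ⟨t, ht⟩ ⟨t', ht'⟩ => ⟨t + t', by simp [mul_add, ht, ht']⟩
  smul_mem' := fun c x ⟨t, ht⟩ => ⟨c * t, by simp [← ht, mul_left_comm]⟩

/-- The elements of `R` whose image is of the form `u * r` with `r` in `R`. -/
def numeratorIdeal (R : Type u) [CommRing R] [Algebra R K] (u : K) : Ideal R where
  carrier := {t | ∃ r, u * algebraMap R K r = algebraMap R K t}
  zero_mem' := ⟨0, by simp⟩
  add_mem' := fun ⟨t, ht⟩ ⟨t', ht'⟩ => ⟨t + t', by simp [mul_add, ht, ht']⟩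
  smul_mem' := fun c x ⟨t, ht⟩ => ⟨c * t, by simp [← ht, mul_left_comm]⟩

theorem isDeltaIdeal_denominatorIdeal {u : K} (hu : u ∈ deltaConstants K Δ)
    (hker : IsDeltaIdeal k R Δ (RingHom.ker (algebraMap R K))) :
    IsDeltaIdeal k R Δ (denominatorIdeal R u) :=
  fun _ hδ _ ⟨_, ht⟩ => ⟨_, mul_algebraMap_derivation_eq hu hker ht hδ⟩

theorem isDeltaIdeal_numeratorIdeal {u : K} (hu : u ∈ deltaConstants K Δ)
    (hker : IsDeltaIdeal k R Δ (RingHom.ker (algebraMap R K))) :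
    IsDeltaIdeal k R Δ (numeratorIdeal R u) :=
  fun _ hδ _ ⟨_, ht⟩ => ⟨_, mul_algebraMap_derivation_eq hu hker ht hδ⟩

variable {M : Ideal R} [hM : M.IsMaximal]

/-- Polynomial expressions in an element of the local ring of `K` at `M` can be computed
compatibly with reduction modulo `M`. -/
theorem exists_aeval_mul_eq (c : K) {s t : R} (hs : s ∉ M)
    (hc : c * algebraMap R K s = algebraMap R K t) {x : R ⧸ M}
    (hx : x * Ideal.Quotient.mk M s = Ideal.Quotient.mk M t) (p : k[X]) :
    ∃ e ∉ M, ∃ d, aeval c p * algebraMap R K e = algebraMap R K d ∧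
      aeval x p * Ideal.Quotient.mk M e = Ideal.Quotient.mk M d := by
  induction p using Polynomial.induction_on' with
  | add p q hp hq =>
    obtain ⟨e, he, d, h1, h2⟩ := hp
    obtain ⟨e', he', d', h1', h2'⟩ := hq
    refine ⟨e * e', fun h => (hM.isPrime.mem_or_mem h).elim he he', d * e' + d' * e, ?_, ?_⟩
    · simp only [map_add, map_mul]
      linear_combination algebraMap R K e' * h1 + algebraMap R K e * h1'
    · simp only [map_add, map_mul]
      linear_combination Ideal.Quotient.mk M e' * h2 + Ideal.Quotient.mk M e * h2'
  | monomial n a =>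
    refine ⟨s ^ n, fun h => hs (hM.isPrime.mem_of_pow_mem n h), algebraMap k R a * t ^ n, ?_, ?_⟩
    · rw [aeval_monomial, map_pow, map_mul, map_pow, ← hc, ← IsScalarTower.algebraMap_apply]
      ring
    · rw [aeval_monomial, map_pow, map_mul, map_pow, ← hx, Ideal.Quotient.mk_algebraMap]
      ring

theorem isAlgebraic_of_mem_deltaConstants (hrank : Module.rank k R < Cardinal.mk k)
    (hcore : deltaCore k R Δ M = RingHom.ker (algebraMap R K)) {c : K}
    (hc : c ∈ deltaConstants K Δ) : IsAlgebraic k c := by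
  have hker : IsDeltaIdeal k R Δ (RingHom.ker (algebraMap R K)) :=
    hcore ▸ isDeltaIdeal_deltaCore M
  have hkerM : RingHom.ker (algebraMap R K) ≤ M := hcore ▸ deltaCore_le M
  let _ : Field (R ⧸ M) := Ideal.Quotient.field M
  have hden : ¬ denominatorIdeal R c ≤ M := fun hle => by
    have hle' := hcore ▸ (isDeltaIdeal_denominatorIdeal hc hker).le_deltaCore hle
    obtain ⟨a, b, hb, rfl, -⟩ := hc
    exact hb (hle' ⟨a, div_mul_cancel₀ _ hb⟩)
  obtain ⟨s, ⟨t, hst⟩, hs⟩ := SetLike.not_le_iff_exists.1 hden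
  have hs0 : Ideal.Quotient.mk M s ≠ 0 := fun h => hs (Ideal.Quotient.eq_zero_iff_mem.1 h)
  have hx := div_mul_cancel₀ (Ideal.Quotient.mk M t) hs0
  set x := Ideal.Quotient.mk M t / Ideal.Quotient.mk M s
  have halg : IsAlgebraic k x :=
    isAlgebraic_of_forall_sub_inv_mem_range hrank (Ideal.Quotient.mkₐ k M).toLinearMap x
      fun l => Ideal.Quotient.mkₐ_surjective k M _
  obtain ⟨p, hp, hpx⟩ := halg
  obtain ⟨e, he, d, hed, hxd⟩ := exists_aeval_mul_eq c hs hst hx p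
  have hd : d ∈ M := Ideal.Quotient.eq_zero_iff_mem.1 (by rw [← hxd, hpx, zero_mul])
  have hnum : numeratorIdeal R (aeval c p) ≤ M := by
    rintro t' ⟨r, hr⟩
    have hmem : e * t' - d * r ∈ M := hkerM <| by
      rw [RingHom.mem_ker, map_sub, map_mul, map_mul, ← hr, ← hed]
      ring
    have het : e * t' ∈ M := (M.sub_mem_iff_left (M.mul_mem_right r hd)).1 hmem
    exact (hM.isPrime.mem_or_mem het).resolve_left he
  have hconst : aeval c p ∈ deltaConstants K Δ :=
    Algebra.adjoin_le (Set.singleton_subset_iff.2 hc) (aeval_mem_adjoin_singleton k c)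
  have hd0 : algebraMap R K d = 0 :=
    (hcore ▸ (isDeltaIdeal_numeratorIdeal hconst hker).le_deltaCore hnum :) ⟨e, hed⟩
  refine ⟨p, hp, (mul_eq_zero.1 (hed.trans hd0)).resolve_right fun h => he (hkerM h)⟩

end Constants

/-- If `R` is noetherian with `dim_k R < |k|`, then for a `Δ`-prime ideal `P`: locally closed in
`Δ`-spec `R` implies `Δ`-primitive, and `Δ`-primitive implies `Δ`-rational. -/
theorem locallyClosed_imp_primitive_imp_rational (k R : Type u) [Field k] [CharZero k] [CommRing R]
    [Algebra k R] [IsNoetherianRing R]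
    (hrank : Module.rank k R < Cardinal.mk k)
    (Δ : Set (Derivation k R R)) (P : PrimeSpectrum R) (hP : IsDeltaIdeal k R Δ P.asIdeal) :
    (IsLocallyClosed ({⟨P, hP⟩} : Set (DeltaSpec k R Δ)) → IsDeltaPrimitive k R Δ P.asIdeal) ∧
    (IsDeltaPrimitive k R Δ P.asIdeal → IsDeltaRational k R Δ P.asIdeal P.isPrime) := by
  constructor
  · intro hlc
    obtain ⟨f, hf, hsep⟩ := exists_separating_of_isLocallyClosed hlc
    have hrank' : Module.rank k (R ⧸ P.asIdeal) < Cardinal.mk k :=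
      (LinearMap.rank_le_of_surjective (Ideal.Quotient.mkₐ k P.asIdeal).toLinearMap
        (Ideal.Quotient.mkₐ_surjective k P.asIdeal)).trans_lt hrank
    obtain ⟨N, hN, hfN⟩ := exists_isMaximal_notMem hrank'
      (fun h => hf (Ideal.Quotient.eq_zero_iff_mem.1 h) : Ideal.Quotient.mk P.asIdeal f ≠ 0)
    have hM : (N.comap (Ideal.Quotient.mk P.asIdeal)).IsMaximal :=
      Ideal.comap_isMaximal_of_surjective _ Ideal.Quotient.mk_surjective
    have hPM : P.asIdeal ≤ N.comap (Ideal.Quotient.mk P.asIdeal) := fun x hx => by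
      rw [Ideal.mem_comap, Ideal.Quotient.eq_zero_iff_mem.2 hx]
      exact N.zero_mem
    exact ⟨_, hM, hsep _ ⟨deltaCore_isPrime _, isDeltaIdeal_deltaCore _⟩ (hP.le_deltaCore hPM)
      fun h => hfN (Ideal.mem_comap.1 (deltaCore_le _ h))⟩
  · rintro ⟨M, hM, hcore⟩ a b hb hab
    let K := FractionRing (R ⧸ P.asIdeal)
    have hmap (x : R) : algebraMap R K x = algebraMap (R ⧸ P.asIdeal) K
        (Ideal.Quotient.mk P.asIdeal x) := rfl
    have hzero (x : R) : algebraMap R K x = 0 ↔ x ∈ P.asIdeal := by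
      rw [hmap, FaithfulSMul.algebraMap_eq_zero_iff, Ideal.Quotient.eq_zero_iff_mem]
    have hker : RingHom.ker (algebraMap R K) = P.asIdeal := Ideal.ext hzero
    refine isAlgebraic_of_mem_deltaConstants (R := R) (Δ := Δ) (M := M) hrank
      (hcore.trans hker.symm) ⟨a, b, mt (hzero b).1 hb, rfl, fun δ hδ => ?_⟩
    rw [← sub_eq_zero, ← map_mul, ← map_mul, ← map_sub]
    exact (hzero _).2 (hab δ hδ)
end

section
/- Let k be a field of characteristic zero and (R, Δ) a commutative differential k-algebra with R noetherian, dim_k R < |k|, and |Δ| < |k|. Then a Δ-prime ideal P of R is Δ-rational if and only if P is |k|-separable in Δ-spec R. -/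
universe u

section MinimalPrimes

theorem Ideal.exists_notMem_mul_pow_mem_of_mem_minimalPrimes {R : Type*} [CommRing R]
    {J p : Ideal R} (hp : p ∈ J.minimalPrimes) {x : R} (hx : x ∈ p) :
    ∃ s ∉ p, ∃ n : ℕ, s * x ^ n ∈ J := by
  have hpp : p.IsPrime := hp.1.1
  by_contra! h
  have hdisj : Disjoint (J : Set R) (p.primeCompl ⊔ Submonoid.powers x : Submonoid R) := by
    rw [Set.disjoint_left]
    intro y hy hy'
    obtain ⟨s, hs, z, ⟨n, rfl⟩, rfl⟩ := Submonoid.mem_sup.1 hy'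
    exact h s hs n hy
  obtain ⟨q, hq, hJq, hqd⟩ := Ideal.exists_le_prime_disjoint J _ hdisj
  have hqp : q ≤ p := by
    intro y hy
    by_contra hyp
    exact Set.disjoint_left.1 hqd hy (Submonoid.mem_sup_left (S := p.primeCompl) hyp)
  exact Set.disjoint_left.1 hqd (hp.2 ⟨hq, hJq⟩ hqp hx)
    (Submonoid.mem_sup_right (Submonoid.mem_powers x))

variable {k R : Type*} [Field k] [CharZero k] [CommRing R] [Algebra k R]

theorem Derivation.mem_of_mul_pow_mem (δ : Derivation k R R) {J p : Ideal R}
    (hp : p.IsPrime) (hJp : J ≤ p) (hJ : ∀ x ∈ J, δ x ∈ J) (x : R) (n : ℕ) :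
    ∀ (s : R) (e : ℕ), s ∉ p → s * x ^ n * δ x ^ e ∈ J → δ x ∈ p := by
  induction n with
  | zero =>
    intro s e hs h
    have h1 : s * δ x ^ e ∈ p := hJp (by simpa using h)
    exact hp.mem_of_pow_mem _ ((hp.mem_or_mem h1).resolve_left hs)
  | succ n ih =>
    intro s e hs h
    refine ih (s * s) (e + 2) (fun h' => (hp.mem_or_mem h').elim hs hs) ?_
    set y := δ x with hy
    have hye : y * δ (y ^ e) = e * y ^ e * δ y := by
      cases e with
      | zero => simp
      | succ e =>
        rw [Derivation.leibniz_pow]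
        simp only [Nat.add_sub_cancel, nsmul_eq_mul, smul_eq_mul]
        ring
    have hx : δ (x ^ (n + 1)) = (n + 1 : ℕ) * x ^ n * y := by
      rw [Derivation.leibniz_pow]
      simp only [Nat.add_sub_cancel, nsmul_eq_mul, smul_eq_mul]
      ring
    have hT := hJ _ h
    have key : ((n + 1 : ℕ) : R) * (s * s * x ^ n * y ^ (e + 2)) =
        s * y * δ (s * x ^ (n + 1) * y ^ e)
          - (δ s * y + e * s * δ y) * (s * x ^ (n + 1) * y ^ e) := by
      simp only [Derivation.leibniz, smul_eq_mul, hx]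
      linear_combination (-s * s * x ^ (n + 1)) * hye
    have hmem : ((n + 1 : ℕ) : R) * (s * s * x ^ n * y ^ (e + 2)) ∈ J := by
      rw [key]
      exact J.sub_mem (J.mul_mem_left _ hT) (J.mul_mem_left _ h)
    have hinv : algebraMap k R ((n + 1 : ℕ) : k)⁻¹ * ((n + 1 : ℕ) : R) = 1 := by
      rw [← _root_.map_natCast (algebraMap k R), ← _root_.map_mul,
        inv_mul_cancel₀ (Nat.cast_ne_zero.2 n.succ_ne_zero), _root_.map_one]
    have := J.mul_mem_left (algebraMap k R ((n + 1 : ℕ) : k)⁻¹) hmem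
    rwa [← mul_assoc, hinv, one_mul] at this

/-- In characteristic zero the minimal primes over a differential ideal are differential ideals. -/
theorem Derivation.mem_of_mem_minimalPrimes (δ : Derivation k R R) {J p : Ideal R}
    (hJ : ∀ x ∈ J, δ x ∈ J) (hp : p ∈ J.minimalPrimes) {x : R} (hx : x ∈ p) : δ x ∈ p := by
  obtain ⟨s, hs, n, h⟩ := Ideal.exists_notMem_mul_pow_mem_of_mem_minimalPrimes hp hx
  exact δ.mem_of_mul_pow_mem hp.1.1 hp.1.2 hJ x n s 0 hs (by simpa using h)

end MinimalPrimes

section Extension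

variable {k R K : Type*} [Field k] [CommRing R] [Algebra k R] [Field K] [Algebra k K]
  [Algebra R K] [IsScalarTower k R K]

open TrivSqZeroExt in
/-- A derivation preserving a prime `P` extends to the fraction field of `R ⧸ P`. -/
theorem Derivation.exists_extend_fractionRing (δ : Derivation k R R) (P : Ideal R) [P.IsPrime]
    [Algebra (R ⧸ P) K] [IsFractionRing (R ⧸ P) K] [IsScalarTower R (R ⧸ P) K]
    (hP : ∀ x ∈ P, δ x ∈ P) :
    ∃ D : Derivation k K K, ∀ r : R, D (algebraMap R K r) = algebraMap R K (δ r) := by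
  have hφ : ∀ r : R, algebraMap R K r = algebraMap (R ⧸ P) K (Ideal.Quotient.mk P r) :=
    fun r => IsScalarTower.algebraMap_apply R (R ⧸ P) K r
  let f : R →+* TrivSqZeroExt K K :=
    { toFun := fun r => inl (algebraMap R K r) + inr (algebraMap R K (δ r))
      map_one' := by ext <;> simp
      map_zero' := by ext <;> simp
      map_add' := fun x y => by ext <;> simp [-DualNumber.inr_eq_smul_eps]
      map_mul' := fun x y => by
        ext
        · simp
        · simp [-DualNumber.inr_eq_smul_eps, mul_comm] }
  have hf : ∀ r ∈ P, f r = 0 := by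
    intro r hr
    have h1 : algebraMap R K r = 0 := by rw [hφ, Ideal.Quotient.eq_zero_iff_mem.2 hr, map_zero]
    have h2 : algebraMap R K (δ r) = 0 := by
      rw [hφ, Ideal.Quotient.eq_zero_iff_mem.2 (hP r hr), map_zero]
    ext <;> simp [-DualNumber.inr_eq_smul_eps, f, h1, h2]
  let g : R ⧸ P →+* TrivSqZeroExt K K := Ideal.Quotient.lift P f hf
  have hg : ∀ r, g (Ideal.Quotient.mk P r) = f r := fun r => Ideal.Quotient.lift_mk P f hf
  have hfst : ∀ x, (g x).fst = algebraMap (R ⧸ P) K x := by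
    intro x
    obtain ⟨r, rfl⟩ := Ideal.Quotient.mk_surjective x
    rw [hg, ← hφ]
    simp [f]
  have hunit : ∀ y : nonZeroDivisors (R ⧸ P), IsUnit (g y) := by
    intro y
    rw [isUnit_iff_isUnit_fst, hfst, isUnit_iff_ne_zero]
    exact IsFractionRing.to_map_ne_zero_of_mem_nonZeroDivisors y.2
  let F : K →+* TrivSqZeroExt K K := IsLocalization.lift hunit
  have hF : ∀ x, F (algebraMap (R ⧸ P) K x) = g x := fun x => IsLocalization.lift_eq hunit x
  have hFφ : ∀ r, F (algebraMap R K r) = f r := fun r => by rw [hφ, hF, hg]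
  have hFfst : ∀ x : K, (F x).fst = x := by
    have : ((fstHom K K K).toRingHom.comp F) = RingHom.id K := by
      refine IsLocalization.ringHom_ext (nonZeroDivisors (R ⧸ P)) ?_
      ext x
      simpa [hF] using hfst _
    exact fun x => DFunLike.congr_fun this x
  have hmul : ∀ x y : K, (F (x * y)).snd = x * (F y).snd + y * (F x).snd := by
    intro x y
    rw [_root_.map_mul, snd_mul, hFfst, hFfst, smul_eq_mul, MulOpposite.smul_eq_mul_unop,
      MulOpposite.unop_op, mul_comm y]
  refine ⟨Derivation.mk'
    { toFun := fun x => (F x).snd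
      map_add' := fun x y => by simp
      map_smul' := fun c x => ?_ } (fun x y => by simpa using hmul x y), fun r => ?_⟩
  · have h0 : (F (algebraMap k K c)).snd = 0 := by
      rw [IsScalarTower.algebraMap_apply k R K, hFφ]
      simp [f]
    rw [Algebra.smul_def, hmul, h0]
    simp [Algebra.smul_def]
  · change (F _).snd = _
    rw [hFφ]
    simp [-DualNumber.inr_eq_smul_eps, f]

end Extension

section Constants

variable {k K κ : Type*} [Field k] [Field K] [Algebra k K]

/-- The field of common constants of a family of derivations of a field. -/
def derivationConstants (E : κ → Derivation k K K) : IntermediateField k K where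
  carrier := {x | ∀ j, E j x = 0}
  mul_mem' := fun {x y} hx hy j => by simp [hx j, hy j]
  add_mem' := fun {x y} hx hy j => by simp [hx j, hy j]
  algebraMap_mem' := fun c j => by simp
  inv_mem' := fun x hx j => by simp [Derivation.leibniz_inv, hx j]

theorem mem_derivationConstants {E : κ → Derivation k K K} {x : K} :
    x ∈ derivationConstants E ↔ ∀ j, E j x = 0 := Iff.rfl

/-- A form of the Wronskian criterion: the span of a differentially stable set of vectors
containing a vector with entries independent over the constants is everything. -/
theorem span_eq_top_of_linearIndependent_constants {ι : Type*} [Fintype ι]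
    (E : κ → Derivation k K K) (s : ι → K)
    (hs : LinearIndependent (derivationConstants E) s) (W : Set (ι → K)) (hsW : s ∈ W)
    (hW : ∀ v ∈ W, ∀ j, (fun i => E j (v i)) ∈ W) : Submodule.span K W = ⊤ := by
  classical
  by_contra hne
  let A : Set (ι → K) := {c | ∀ v ∈ W, ∑ i, c i * v i = 0}
  have hex : ∃ c, c ∈ A ∧ c ≠ 0 := by
    obtain ⟨f, hf, hle⟩ := Submodule.exists_le_ker_of_lt_top _ (lt_top_iff_ne_top.2 hne)
    have hfv : ∀ v, f v = ∑ i, f (Pi.single i 1) * v i := by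
      intro v
      conv_lhs => rw [pi_eq_sum_univ' v]
      rw [map_sum]
      refine Finset.sum_congr rfl fun i _ => ?_
      rw [map_smul, smul_eq_mul, mul_comm]
    refine ⟨fun i => f (Pi.single i 1), fun v hv => ?_, fun h0 => hf ?_⟩
    · rw [← hfv]
      exact hle (Submodule.subset_span hv)
    · ext i
      simpa using congrFun h0 i
  have hcard : ∃ n, ∃ c, c ∈ A ∧ c ≠ 0 ∧ (Finset.univ.filter fun i => c i ≠ 0).card = n := by
    obtain ⟨c, hc, hc0⟩ := hex
    exact ⟨_, c, hc, hc0, rfl⟩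
  obtain ⟨c₀, hc₀, hc₀0, hcn⟩ := Nat.find_spec hcard
  have hmin := fun m => Nat.find_min hcard (m := m)
  rw [← hcn] at hmin
  obtain ⟨i₀, hi₀⟩ := Function.ne_iff.1 hc₀0
  have hi₀ : c₀ i₀ ≠ 0 := hi₀
  let c : ι → K := fun i => (c₀ i₀)⁻¹ * c₀ i
  have hcA : c ∈ A := fun v hv => by
    simp only [c, mul_assoc, ← Finset.mul_sum, hc₀ v hv, mul_zero]
  have hci : c i₀ = 1 := inv_mul_cancel₀ hi₀
  have hDc : ∀ j, (fun i => E j (c i)) = 0 := by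
    intro j
    by_contra h0
    refine hmin _ (Finset.card_lt_card ?_) ⟨fun i => E j (c i), fun v hv => ?_, h0, rfl⟩
    · refine (Finset.ssubset_iff_of_subset fun i hi => ?_).2 ⟨i₀, by simpa using hi₀, ?_⟩
      · simp only [Finset.mem_filter, Finset.mem_univ, true_and] at hi ⊢
        intro hi0
        exact hi (by simp [c, hi0])
      · simp [hci]
    · have h1 := congrArg (E j) (hcA v hv)
      simp only [map_sum, Derivation.leibniz, smul_eq_mul, map_zero, Finset.sum_add_distrib] at h1
      rw [hcA _ (hW v hv j), zero_add] at h1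
      rw [← h1]
      exact Finset.sum_congr rfl fun i _ => mul_comm _ _
  have hconst : ∀ i, c i ∈ derivationConstants E := fun i j => congrFun (hDc j) i
  have := Fintype.linearIndependent_iff.1 hs (fun i => ⟨c i, hconst i⟩) (hcA s hsW) i₀
  exact one_ne_zero (hci.symm.trans (congrArg Subtype.val this))

end Constants

section Separation

open Cardinal

variable {k R K : Type u} [Field k] [CommRing R] [Algebra k R] [Field K] [Algebra k K]
  [Algebra R K]

/-- The vectors obtained from `s` by applying finitely many derivations of `Δ` entrywise. -/
inductive DeltaOrbit {ι : Type*} (Δ : Set (Derivation k R R)) (s : ι → R) : (ι → R) → Prop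
  | base : DeltaOrbit Δ s s
  | step (δ : Derivation k R R) (hδ : δ ∈ Δ) (v : ι → R) (hv : DeltaOrbit Δ s v) :
      DeltaOrbit Δ s (fun i => δ (v i))

theorem DeltaOrbit.sum_mem_map {ι : Type*} [Fintype ι] {Δ : Set (Derivation k R R)}
    {E : Δ → Derivation k K K}
    (hE : ∀ δ r, E δ (algebraMap R K r) = algebraMap R K (δ.1 r)) {s v : ι → R}
    (hv : DeltaOrbit Δ s v) {Q : Ideal R} (hQ : IsDeltaIdeal k R Δ Q) {γ : ι → K}
    (hγ : ∀ i, γ i ∈ derivationConstants E)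
    (hs : ∑ i, γ i * algebraMap R K (s i) ∈ Submodule.map (Algebra.linearMap R K) Q) :
    ∑ i, γ i * algebraMap R K (v i) ∈ Submodule.map (Algebra.linearMap R K) Q := by
  induction hv with
  | base => exact hs
  | step δ hδ v _ ih =>
    obtain ⟨q, hq, hqv⟩ := ih
    refine ⟨δ q, hQ δ hδ q hq, ?_⟩
    have h := congrArg (E ⟨δ, hδ⟩) hqv
    simp only [Algebra.linearMap_apply, hE, map_sum, Derivation.leibniz, smul_eq_mul,
      hγ _ ⟨δ, hδ⟩, mul_zero, add_zero] at h
    simpa using h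

/-- A common multiplier for all constant-coefficient relations of `s` modulo differential
ideals. -/
theorem exists_mul_coeff_mem_map {ι : Type*} [Fintype ι] {Δ : Set (Derivation k R R)}
    {E : Δ → Derivation k K K}
    (hE : ∀ δ r, E δ (algebraMap R K r) = algebraMap R K (δ.1 r))
    (hfrac : ∀ x : K, ∃ a b : R, algebraMap R K b ≠ 0 ∧ x = algebraMap R K a / algebraMap R K b)
    (s : ι → R)
    (hs : LinearIndependent (derivationConstants E) fun i => algebraMap R K (s i)) :
    ∃ d : R, algebraMap R K d ≠ 0 ∧ ∀ Q : Ideal R, IsDeltaIdeal k R Δ Q → ∀ γ : ι → K,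
      (∀ i, γ i ∈ derivationConstants E) →
      ∑ i, γ i * algebraMap R K (s i) ∈ Submodule.map (Algebra.linearMap R K) Q →
      ∀ i, d • γ i ∈ Submodule.map (Algebra.linearMap R K) Q := by
  classical
  have htop := span_eq_top_of_linearIndependent_constants E _ hs
    ((fun v i => algebraMap R K (v i)) '' {v | DeltaOrbit Δ s v}) ⟨s, DeltaOrbit.base, rfl⟩ (by
      rintro _ ⟨v, hv, rfl⟩ j
      exact ⟨_, DeltaOrbit.step j.1 j.2 v hv, by simp [hE]⟩)
  have key : ∀ x : ι → K, ∃ d : R, algebraMap R K d ≠ 0 ∧ ∀ Q : Ideal R,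
      IsDeltaIdeal k R Δ Q → ∀ γ : ι → K, (∀ i, γ i ∈ derivationConstants E) →
      ∑ i, γ i * algebraMap R K (s i) ∈ Submodule.map (Algebra.linearMap R K) Q →
      d • ∑ i, γ i * x i ∈ Submodule.map (Algebra.linearMap R K) Q := by
    intro x
    have hx : x ∈ Submodule.span K
        ((fun v i => algebraMap R K (v i)) '' {v | DeltaOrbit Δ s v}) := htop ▸ Submodule.mem_top
    induction hx using Submodule.span_induction with
    | mem x hx =>
      obtain ⟨v, hv, rfl⟩ := hx
      exact ⟨1, by simp, fun Q hQ γ hγ h => by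
        rw [one_smul]
        exact hv.sum_mem_map hE hQ hγ h⟩
    | zero => exact ⟨1, by simp, fun Q hQ γ hγ h => by simp⟩
    | add x y _ _ hx hy =>
      obtain ⟨d, hd, hdQ⟩ := hx
      obtain ⟨e, he, heQ⟩ := hy
      refine ⟨d * e, by simp [hd, he], fun Q hQ γ hγ h => ?_⟩
      simp only [Pi.add_apply, mul_add, Finset.sum_add_distrib, smul_add]
      refine Submodule.add_mem _ ?_ ?_
      · rw [mul_comm, mul_smul]
        exact Submodule.smul_mem _ _ (hdQ Q hQ γ hγ h)
      · rw [mul_smul]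
        exact Submodule.smul_mem _ _ (heQ Q hQ γ hγ h)
    | smul c x _ hx =>
      obtain ⟨d, hd, hdQ⟩ := hx
      obtain ⟨a, b, hb, rfl⟩ := hfrac c
      refine ⟨b * d, by simp [hb, hd], fun Q hQ γ hγ h => ?_⟩
      have : (b * d) • ∑ i, γ i * ((algebraMap R K a / algebraMap R K b) • x) i =
          a • d • ∑ i, γ i * x i := by
        simp only [Algebra.smul_def (A := K) (R := R), Pi.smul_apply, smul_eq_mul, Finset.mul_sum,
          _root_.map_mul]
        refine Finset.sum_congr rfl fun i _ => ?_
        field_simp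
      rw [this]
      exact Submodule.smul_mem _ _ (hdQ Q hQ γ hγ h)
  choose d hd hdQ using fun i : ι => key (Pi.single i 1)
  refine ⟨∏ i, d i, ?_, fun Q hQ γ hγ h i => ?_⟩
  · rw [map_prod]
    exact Finset.prod_ne_zero_iff.2 fun i _ => hd i
  · have h1 := hdQ i Q hQ γ hγ h
    rw [Finset.sum_eq_single i (fun j _ hj => by simp [hj]) (by simp)] at h1
    rw [← Finset.prod_erase_mul _ _ (Finset.mem_univ i), mul_smul]
    exact Submodule.smul_mem _ _ (by simpa using h1)

theorem mem_of_smul_mem_map_of_isIntegral_inv {Q : Ideal R} (hQ : Q.IsPrime)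
    (hker : RingHom.ker (algebraMap R K) ≤ Q) {d : R} {γ : K} (hγ0 : γ ≠ 0)
    (hγ : IsIntegral R γ⁻¹) (h : d • γ ∈ Submodule.map (Algebra.linearMap R K) Q) : d ∈ Q := by
  obtain ⟨q, hq, hqd⟩ := h
  let S := integralClosure R K
  have hkS : RingHom.ker (algebraMap R S) ≤ Q := fun x hx => hker <| by
    rw [RingHom.mem_ker] at hx ⊢
    rw [IsScalarTower.algebraMap_apply R S K, hx, map_zero]
  obtain ⟨Q', hQ', rfl⟩ := Ideal.exists_ideal_over_prime_of_isIntegral_of_isDomain Q hkS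
  have heq : algebraMap R S d = algebraMap R S q * (⟨γ⁻¹, hγ⟩ : S) := by
    apply Subtype.ext
    change algebraMap R K d = algebraMap R K q * γ⁻¹
    rw [Algebra.linearMap_apply, Algebra.smul_def] at hqd
    rw [hqd, mul_inv_cancel_right₀ hγ0]
  rw [Ideal.mem_comap, heq]
  exact Q'.mul_mem_right _ hq

/-- The smallest differential ideal containing a set. -/
theorem exists_least_deltaIdeal (Δ : Set (Derivation k R R)) (S : Set R) :
    ∃ J : Ideal R, IsDeltaIdeal k R Δ J ∧ S ⊆ J ∧
      ∀ Q : Ideal R, IsDeltaIdeal k R Δ Q → S ⊆ Q → J ≤ Q := by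
  refine ⟨sInf {I | IsDeltaIdeal k R Δ I ∧ S ⊆ I}, ?_, ?_, fun Q hQ hS => sInf_le ⟨hQ, hS⟩⟩
  · intro δ hδ x hx
    rw [Submodule.mem_sInf] at hx ⊢
    exact fun I hI => hI.1 δ hδ x (hx I hI)
  · intro x hx
    rw [SetLike.mem_coe, Submodule.mem_sInf]
    exact fun I hI => hI.2 hx

variable (R) in
theorem exists_linearIndependent_range_algebraMap [IsScalarTower k R K]
    (C : IntermediateField k K) :
    ∃ (b : Type u) (r : b → R), Cardinal.mk b ≤ Module.rank k R ∧
      LinearIndependent C (fun i => algebraMap R K (r i)) ∧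
      ∀ x : R, algebraMap R K x ∈ Submodule.span C (Set.range fun i => algebraMap R K (r i)) := by
  obtain ⟨b, hb, hspan, hli⟩ := exists_linearIndependent C (Set.range (algebraMap R K))
  choose r hr using fun x : b => hb x.2
  have hrf : (fun i : b => algebraMap R K (r i)) = Subtype.val := funext hr
  refine ⟨b, r, ?_, hrf ▸ hli, fun x => ?_⟩
  · have h1 : LinearIndependent k (fun i : b => algebraMap R K (r i)) :=
      hrf ▸ hli.restrict_scalars' k
    exact (LinearIndependent.of_comp (IsScalarTower.toAlgHom k R K).toLinearMap
      (v := r) h1).cardinal_le_rank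
  · rw [hrf, Subtype.range_coe, hspan]
    exact Submodule.subset_span ⟨x, rfl⟩

theorem Cardinal.mk_iUnion_finset_lt {b α : Type u} {κ : Cardinal.{u}} (hκ : ℵ₀ ≤ κ)
    (hb : Cardinal.mk b < κ) (f : Finset b → Set α) (hf : ∀ s, (f s).Finite) :
    Cardinal.mk (⋃ s, f s) < κ := by
  cases finite_or_infinite b
  · exact (Set.finite_iUnion hf).lt_aleph0.trans_le hκ
  · refine lt_of_le_of_lt ?_ hb
    calc Cardinal.mk (⋃ s, f s) ≤ Cardinal.sum fun s => Cardinal.mk (f s) :=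
          Cardinal.mk_iUnion_le_sum_mk
      _ ≤ Cardinal.sum fun _ : Finset b => (ℵ₀ : Cardinal.{u}) :=
          Cardinal.sum_le_sum _ _ fun s => (hf s).lt_aleph0.le
      _ = Cardinal.mk b * ℵ₀ := by rw [Cardinal.sum_const', Cardinal.mk_finset_of_infinite]
      _ = Cardinal.mk b := Cardinal.mul_aleph0_eq (Cardinal.aleph0_le_mk b)

theorem deltaSeparable_of_isAlgebraic_constants [CharZero k] [IsScalarTower k R K] [IsNoetherianRing R]
    (hrank : Module.rank k R < Cardinal.mk k) {Δ : Set (Derivation k R R)}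
    {P : Ideal R} (hker : RingHom.ker (algebraMap R K) = P) {E : Δ → Derivation k K K}
    (hE : ∀ δ r, E δ (algebraMap R K r) = algebraMap R K (δ.1 r))
    (hfrac : ∀ x : K, ∃ a b : R, algebraMap R K b ≠ 0 ∧ x = algebraMap R K a / algebraMap R K b)
    (halg : ∀ x ∈ derivationConstants E, IsAlgebraic k x) :
    DeltaSeparable k R Δ (Cardinal.mk k) P := by
  classical
  obtain ⟨b, r, hb, hli, hspan⟩ :=
    exists_linearIndependent_range_algebraMap R (derivationConstants E)
  choose d hd hdQ using fun S : Finset b => exists_mul_coeff_mem_map hE hfrac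
    (fun i : S => r i) (hli.comp _ Subtype.val_injective)
  choose J hJΔ hJS hJle using fun S : Finset b => exists_least_deltaIdeal Δ (insert (d S) (P : Set R))
  have hk : ℵ₀ ≤ Cardinal.mk k := Cardinal.infinite_iff.1 inferInstance
  refine ⟨⋃ S, (J S).minimalPrimes, ?_, Cardinal.mk_iUnion_finset_lt hk (hb.trans_lt hrank) _
    fun S => Ideal.finite_minimalPrimes_of_isNoetherianRing R _, ?_⟩
  · intro Q hQ
    obtain ⟨S, hQ⟩ := Set.mem_iUnion.1 hQ
    refine ⟨⟨hQ.1.1, fun δ hδ x hx => δ.mem_of_mem_minimalPrimes (hJΔ S δ hδ) hQ hx⟩, ?_⟩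
    refine SetLike.lt_iff_le_and_exists.2
      ⟨fun x hx => hQ.1.2 (hJS S (Set.mem_insert_of_mem _ hx)), d S,
        hQ.1.2 (hJS S (Set.mem_insert _ _)), fun h => hd S ?_⟩
    rw [← hker] at h
    exact h
  · intro Q hQ hPQ
    have hQp := hQ.1
    obtain ⟨hPQ, q, hq, hqP⟩ := SetLike.lt_iff_le_and_exists.1 hPQ
    obtain ⟨c, hc⟩ := Finsupp.mem_span_range_iff_exists_finsupp.1 (hspan q)
    have hc0 : c ≠ 0 := by
      rintro rfl
      refine hqP ?_
      rw [← hker, RingHom.mem_ker, ← hc, Finsupp.sum_zero_index]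
    obtain ⟨i, hi⟩ := Finsupp.ne_iff.1 hc0
    have hi : c i ≠ 0 := hi
    have hmem := hdQ c.support Q hQ.2 (fun j => (c j : K)) (fun j => (c j).2) (by
      refine ⟨q, hq, ?_⟩
      rw [Algebra.linearMap_apply, ← hc, Finsupp.sum,
        ← Finset.sum_coe_sort c.support (fun j => c j • algebraMap R K (r j))]
      rfl) ⟨i, Finsupp.mem_support_iff.2 hi⟩
    have hdmem : d c.support ∈ Q := by
      refine mem_of_smul_mem_map_of_isIntegral_inv hQ.1 (hker.le.trans hPQ)
        (γ := (c i : K)) (by simpa using hi) ?_ hmem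
      exact (halg _ (c i)⁻¹.2).isIntegral.tower_top
    have hJQ : J c.support ≤ Q := hJle _ Q hQ.2 (Set.insert_subset hdmem hPQ)
    obtain ⟨Q', hQ', hle⟩ := Ideal.exists_minimalPrimes_le hJQ
    exact ⟨Q', Set.mem_iUnion.2 ⟨_, hQ'⟩, hle⟩

end Separation

section Rationality

open Cardinal

variable {k R : Type u} [Field k] [CommRing R] [Algebra k R]

/-- An ideal which is differential up to a denominator `b ∈ T` and misses `T` lies in a
differential prime missing `T`. -/
theorem exists_deltaPrime_disjoint [CharZero k] {Δ : Set (Derivation k R R)} {I : Ideal R}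
    {T : Submonoid R} {b : R} (hb : b ∈ T) (hI : ∀ δ ∈ Δ, ∀ x ∈ I, b * δ x ∈ I)
    (hT : ∀ t ∈ T, t ∉ I) :
    ∃ Q : Ideal R, IsDeltaPrime k R Δ Q ∧ I ≤ Q ∧ ∀ t ∈ T, t ∉ Q := by
  let J : Ideal R :=
    { carrier := {x | ∃ t ∈ T, t * x ∈ I}
      zero_mem' := ⟨1, T.one_mem, by simp⟩
      add_mem' := by
        rintro x y ⟨t, ht, hx⟩ ⟨u, hu, hy⟩
        refine ⟨t * u, T.mul_mem ht hu, ?_⟩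
        have : t * u * (x + y) = u * (t * x) + t * (u * y) := by ring
        rw [this]
        exact I.add_mem (I.mul_mem_left _ hx) (I.mul_mem_left _ hy)
      smul_mem' := by
        rintro c x ⟨t, ht, hx⟩
        refine ⟨t, ht, ?_⟩
        rw [smul_eq_mul, mul_left_comm]
        exact I.mul_mem_left _ hx }
  have hJΔ : ∀ δ ∈ Δ, ∀ x ∈ J, δ x ∈ J := by
    rintro δ hδ x ⟨t, ht, hx⟩
    refine ⟨t * (b * t), T.mul_mem ht (T.mul_mem hb ht), ?_⟩
    have h := hI δ hδ _ hx
    have : t * (b * t) * δ x = t * (b * δ (t * x)) - b * δ t * (t * x) := by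
      rw [Derivation.leibniz, smul_eq_mul, smul_eq_mul]
      ring
    rw [this]
    exact I.sub_mem (I.mul_mem_left _ h) (I.mul_mem_left _ hx)
  have hJ : J ≠ ⊤ := by
    rw [Ne, Ideal.eq_top_iff_one]
    rintro ⟨t, ht, h⟩
    exact hT t ht (by simpa using h)
  obtain ⟨Q, hQ⟩ := Ideal.nonempty_minimalPrimes hJ
  refine ⟨Q, ⟨hQ.1.1, fun δ hδ x hx => δ.mem_of_mem_minimalPrimes (hJΔ δ hδ) hQ hx⟩,
    fun x hx => hQ.1.2 ⟨1, T.one_mem, by simpa using hx⟩, fun t ht htQ => ?_⟩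
  obtain ⟨s, hs, n, u, hu, h⟩ := Ideal.exists_notMem_mul_pow_mem_of_mem_minimalPrimes hQ htQ
  refine hs (hQ.1.2 ⟨u * t ^ n, T.mul_mem hu (T.pow_mem ht n), ?_⟩)
  rwa [mul_assoc, mul_comm (t ^ n)]

theorem Submonoid.mk_closure_le_max (S : Set R) :
    Cardinal.mk (Submonoid.closure S) ≤ max ℵ₀ (Cardinal.mk S) := by
  refine le_trans ?_ (Cardinal.mk_list_le_max S)
  refine Cardinal.mk_le_of_surjective (f := fun l : List S =>
    (⟨(l.map Subtype.val).prod, Submonoid.list_prod_mem _ fun x hx => ?_⟩ :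
      Submonoid.closure S)) ?_
  · obtain ⟨y, -, rfl⟩ := List.mem_map.1 hx
    exact Submonoid.subset_closure y.2
  · rintro ⟨x, hx⟩
    obtain ⟨l, hl, rfl⟩ := Submonoid.exists_list_of_mem_closure hx
    exact ⟨l.attachWith _ hl, by simp⟩

/-- If all `φ a - c φ b` become invertible after inverting few elements, then `φ a / φ b` is
algebraic. -/
theorem isAlgebraic_div_of_mk_lt {K : Type u} [Field K] [Algebra k K] [Algebra R K]
    [IsScalarTower k R K] (hk : ℵ₀ ≤ Cardinal.mk k) (hrank : Module.rank k R < Cardinal.mk k)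
    {T : Type u} (hT : Cardinal.mk T < Cardinal.mk k) (t : T → R)
    (ht : ∀ i, algebraMap R K (t i) ≠ 0) {a b : R} (hb : algebraMap R K b ≠ 0)
    (h : ∀ c : k, ∃ i r, algebraMap R K (t i) =
      algebraMap R K r * (algebraMap R K a - algebraMap k K c * algebraMap R K b)) :
    IsAlgebraic k (algebraMap R K a / algebraMap R K b) := by
  by_contra htr
  set f := algebraMap R K a / algebraMap R K b with hf
  have hfa : algebraMap R K a = f * algebraMap R K b := (div_mul_cancel₀ _ hb).symm
  choose τ r hτ using h
  have hfib : ∀ i : T, Cardinal.mk {c : k // τ c = i} ≤ Module.rank k R := by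
    intro i
    have h0 : algebraMap R K (t i) / algebraMap R K b ≠ 0 := div_ne_zero (ht i) hb
    have h1 := (Transcendental.linearIndependent_sub_inv htr).comp
      (Subtype.val : {c : k // τ c = i} → k) Subtype.val_injective
    have h2 := h1.map' (LinearMap.mulLeft k (algebraMap R K (t i) / algebraMap R K b))
      (LinearMap.ker_eq_bot.2 (mul_right_injective₀ h0))
    have h3 : (LinearMap.mulLeft k (algebraMap R K (t i) / algebraMap R K b)) ∘
        (fun c => (f - algebraMap k K c)⁻¹) ∘ (Subtype.val : {c : k // τ c = i} → k) =
        (IsScalarTower.toAlgHom k R K).toLinearMap ∘ fun c => r c.1 := by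
      ext ⟨c, rfl⟩
      have h4 := hτ c
      rw [hfa, ← sub_mul] at h4
      have h5 : f - algebraMap k K c ≠ 0 := by
        intro h6
        exact ht (τ c) (by rw [h4, h6]; simp)
      simp only [Function.comp_apply, LinearMap.mulLeft_apply, AlgHom.toLinearMap_apply,
        IsScalarTower.coe_toAlgHom', h4]
      field_simp
    rw [h3] at h2
    exact (LinearIndependent.of_comp _ h2).cardinal_le_rank
  have hle : Cardinal.mk k ≤ Cardinal.mk T * Module.rank k R := by
    calc Cardinal.mk k = Cardinal.mk (Σ i, {c : k // τ c = i}) :=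
          (Cardinal.mk_congr (Equiv.sigmaFiberEquiv τ)).symm
      _ = Cardinal.sum fun i => Cardinal.mk {c : k // τ c = i} := Cardinal.mk_sigma _
      _ ≤ Cardinal.sum fun _ : T => Module.rank k R := Cardinal.sum_le_sum _ _ hfib
      _ = Cardinal.mk T * Module.rank k R := Cardinal.sum_const' _ _
  exact absurd hle (not_le.2 (Cardinal.mul_lt_of_lt hk hT hrank))

theorem isAlgebraic_div_of_deltaSeparable [CharZero k] {K : Type u} [Field K] [Algebra k K]
    [Algebra R K] [IsScalarTower k R K] (hrank : Module.rank k R < Cardinal.mk k)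
    {Δ : Set (Derivation k R R)} {P : Ideal R} (hP : P.IsPrime) (hPΔ : IsDeltaIdeal k R Δ P)
    (hker : RingHom.ker (algebraMap R K) = P) (hsep : DeltaSeparable k R Δ (Cardinal.mk k) P)
    {a b : R} (hb : b ∉ P) (hab : ∀ δ ∈ Δ, δ a * b - a * δ b ∈ P) :
    IsAlgebraic k (algebraMap R K a / algebraMap R K b) := by
  have hmem : ∀ x : R, algebraMap R K x = 0 ↔ x ∈ P := fun x => by
    rw [← hker, RingHom.mem_ker]
  have hk : ℵ₀ ≤ Cardinal.mk k := Cardinal.infinite_iff.1 inferInstance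
  rcases hk.eq_or_lt with hk0 | hk0
  · rw [← hk0] at hrank
    have : Module.Finite k R := Module.rank_lt_aleph0_iff.1 hrank
    have hint : ∀ x : R, IsAlgebraic k (algebraMap R K x) := fun x =>
      ((Algebra.IsIntegral.isIntegral (R := k) x).map (IsScalarTower.toAlgHom k R K)).isAlgebraic
    rw [div_eq_mul_inv]
    exact (hint a).mul (hint b).inv
  by_contra htr
  obtain ⟨Λ, hΛ, hΛk, hΛsep⟩ := hsep
  choose! g hgQ hgP using fun Q (hQ : Q ∈ Λ) => (SetLike.lt_iff_le_and_exists.1 (hΛ Q hQ).2).2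
  let T : Submonoid R := Submonoid.closure (insert b (g '' Λ))
  have hTP : ∀ t ∈ T, t ∉ P := by
    have : T ≤ P.primeCompl := by
      refine Submonoid.closure_le.2 (Set.insert_subset hb ?_)
      rintro _ ⟨Q, hQ, rfl⟩
      exact hgP Q hQ
    exact this
  have hbT : b ∈ T := Submonoid.subset_closure (Set.mem_insert _ _)
  have hTk : Cardinal.mk T < Cardinal.mk k := by
    refine (Submonoid.mk_closure_le_max _).trans_lt (max_lt hk0 ?_)
    refine (Cardinal.mk_insert_le).trans_lt (Cardinal.add_lt_of_lt hk ?_ ?_)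
    · exact Cardinal.mk_image_le.trans_lt hΛk
    · exact Cardinal.one_lt_aleph0.trans hk0
  refine htr (isAlgebraic_div_of_mk_lt hk hrank hTk (fun t : T => (t : R))
    (fun t => fun h => hTP t t.2 ((hmem _).1 h)) (fun h => hb ((hmem _).1 h)) fun c => ?_)
  set e := a - algebraMap k R c * b with he
  have heφ : algebraMap R K e =
      algebraMap R K a - algebraMap k K c * algebraMap R K b := by
    rw [he, map_sub, map_mul, ← IsScalarTower.algebraMap_apply]
  by_contra! hcon
  have hI : ∀ δ ∈ Δ, ∀ x ∈ Ideal.span {e} ⊔ P, b * δ x ∈ Ideal.span {e} ⊔ P := by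
    intro δ hδ x hx
    obtain ⟨r, p, hp, rfl⟩ := Ideal.mem_span_singleton_sup.1 hx
    have h1 : b * δ (r * e + p) =
        (b * δ r + r * δ b) * e + (r * (δ a * b - a * δ b) + b * δ p) := by
      simp only [he, map_add, map_sub, Derivation.leibniz, Derivation.map_algebraMap, smul_eq_mul]
      ring
    rw [h1]
    exact Ideal.mem_span_singleton_sup.2 ⟨_, _, P.add_mem (P.mul_mem_left _ (hab δ hδ))
      (P.mul_mem_left _ (hPΔ δ hδ p hp)), rfl⟩
  obtain ⟨Q, hQ, hIQ, hQT⟩ := exists_deltaPrime_disjoint hbT hI fun t ht htI => by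
    obtain ⟨r, p, hp, hrp⟩ := Ideal.mem_span_singleton_sup.1 htI
    refine hcon ⟨t, ht⟩ r ?_
    rw [← heφ, ← map_mul]
    simp [← hrp, (hmem p).2 hp]
  have hPQ : P < Q := by
    refine SetLike.lt_iff_le_and_exists.2 ⟨le_sup_right.trans hIQ, e,
      hIQ (Ideal.mem_sup_left (Ideal.mem_span_singleton_self e)), fun h => htr ?_⟩
    rw [← hmem, heφ, sub_eq_zero] at h
    rw [h, mul_div_cancel_right₀ _ fun h => hb ((hmem _).1 h)]
    exact isAlgebraic_algebraMap c
  obtain ⟨Q', hQ', hle⟩ := hΛsep Q hQ hPQ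
  exact hQT _ (Submonoid.subset_closure (Set.mem_insert_of_mem _ ⟨Q', hQ', rfl⟩))
    (hle (hgQ Q' hQ'))

end Rationality

/-- If `R` is noetherian with `dim_k R < |k|` and `|Δ| < |k|`, a `Δ`-prime ideal is `Δ`-rational
iff it is `|k|`-separable in `Δ`-spec `R`. -/
theorem deltaRational_iff_card_separable (k R : Type u) [Field k] [CharZero k] [CommRing R]
    [Algebra k R] [IsNoetherianRing R]
    (hrank : Module.rank k R < Cardinal.mk k)
    (Δ : Set (Derivation k R R)) (hΔ : Cardinal.mk Δ < Cardinal.mk k)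
    (P : Ideal R) (hP : P.IsPrime) (hPΔ : IsDeltaIdeal k R Δ P) :
    IsDeltaRational k R Δ P hP ↔ DeltaSeparable k R Δ (Cardinal.mk k) P := by
  have := hP
  let K := FractionRing (R ⧸ P)
  have hφ : ∀ r : R, algebraMap R K r = algebraMap (R ⧸ P) K (Ideal.Quotient.mk P r) :=
    fun r => IsScalarTower.algebraMap_apply R (R ⧸ P) K r
  have hmem : ∀ r : R, algebraMap R K r = 0 ↔ r ∈ P := fun r => by
    rw [hφ, IsFractionRing.to_map_eq_zero_iff, Ideal.Quotient.eq_zero_iff_mem]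
  have hker : RingHom.ker (algebraMap R K) = P := Ideal.ext hmem
  refine ⟨fun hrat => ?_, fun hsep a b hb hab => ?_⟩
  · choose E hE using fun δ : Δ =>
      Derivation.exists_extend_fractionRing (K := K) δ.1 P (hPΔ δ.1 δ.2)
    have hfrac : ∀ x : K, ∃ a b : R, algebraMap R K b ≠ 0 ∧
        x = algebraMap R K a / algebraMap R K b := by
      intro x
      obtain ⟨a, b, hb, rfl⟩ := IsFractionRing.div_surjective (A := R ⧸ P) x
      obtain ⟨a, rfl⟩ := Ideal.Quotient.mk_surjective a
      obtain ⟨b, rfl⟩ := Ideal.Quotient.mk_surjective b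
      refine ⟨a, b, ?_, by rw [hφ, hφ]⟩
      rw [hφ]
      exact IsFractionRing.to_map_ne_zero_of_mem_nonZeroDivisors hb
    refine deltaSeparable_of_isAlgebraic_constants hrank hker hE hfrac fun x hx => ?_
    obtain ⟨a, b, hb, rfl⟩ := hfrac x
    refine hrat a b (fun h => hb ((hmem b).2 h)) fun δ hδ => ?_
    have h := mem_derivationConstants.1 hx ⟨δ, hδ⟩
    rw [Derivation.leibniz_div, hE, hE, smul_eq_mul, smul_eq_mul, smul_eq_mul] at h
    rw [← hmem, map_sub, map_mul, map_mul]
    have := (mul_eq_zero.1 h).resolve_left (by simp [hb])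
    linear_combination this
  · exact isAlgebraic_div_of_deltaSeparable (K := K) hrank hP hPΔ hker hsep hb hab
end

section
/- Let k be a field of characteristic zero and (R, Δ) a commutative differential k-algebra with R noetherian, dim_k R < |k|, and |Δ| < |k|. If every point of Δ-spec R is ℵ₀-separable, then R satisfies the Δ-Dixmier-Moeglin equivalence. In particular, if the set of Δ-primitive ideals of R is finite, then R satisfies the Δ-Dixmier-Moeglin equivalence. -/
universe u

namespace DifferentialAlgebra

variable {k R : Type u} [Field k] [CommRing R] [Algebra k R]

theorem isAlgebraic_of_forall_pow_div_sub_mem {D K : Type u} [CharZero k] [CommRing D] [IsDomain D]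
    [Algebra k D] [Field K] [Algebra D K] [Algebra k K] [IsScalarTower k D K] [IsFractionRing D K]
    (hrank : Module.rank k D < Cardinal.mk k) (z : K) (g : D) (hg : g ≠ 0)
    (h : ∀ c : k, c ≠ 0 → ∃ (n : ℕ) (y : D),
      algebraMap D K g ^ n * (z - algebraMap k K c)⁻¹ = algebraMap D K y) :
    IsAlgebraic k z := by
  by_contra hz
  rcases lt_or_ge (Module.rank k D) Cardinal.aleph0 with hfin | hinf
  · have : Module.Finite k D := Module.rank_lt_aleph0_iff.mp hfin
    have : Algebra.IsAlgebraic k K :=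
      have := IsLocalization.isAlgebraic (R := D) (S := K) (nonZeroDivisors D)
      Algebra.IsAlgebraic.trans k D K
    exact hz (Algebra.IsAlgebraic.isAlgebraic z)
  have hg' : algebraMap D K g ≠ 0 := by
    simpa using hg
  let e := Module.Free.chooseBasis k D
  let v : ℕ × Module.Free.ChooseBasisIndex k D → K :=
    fun p ↦ (algebraMap D K g ^ p.1)⁻¹ * algebraMap D K (e p.2)
  let S : Submodule k K := Submodule.span k (Set.range v)
  have hS : Module.rank k S ≤ Module.rank k D := by
    refine (rank_span_le _).trans (Cardinal.mk_range_le.trans ?_)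
    rw [Cardinal.mk_prod, ← Module.Free.rank_eq_card_chooseBasisIndex]
    simpa using Cardinal.mul_le_of_le hinf hinf le_rfl
  have hmem : ∀ (n : ℕ) (y : D), (algebraMap D K g ^ n)⁻¹ * algebraMap D K y ∈ S := by
    intro n y
    let φ : D →ₗ[k] K := (LinearMap.mulLeft k (algebraMap D K g ^ n)⁻¹) ∘ₗ
      (IsScalarTower.toAlgHom k D K).toLinearMap
    have hφ : Submodule.map φ ⊤ ≤ S := by
      rw [← e.span_eq, Submodule.map_span_le]
      rintro _ ⟨i, rfl⟩
      exact Submodule.subset_span ⟨(n, i), rfl⟩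
    exact hφ ⟨y, trivial, rfl⟩
  have hmem' : ∀ c : {c : k // c ≠ 0}, (z - algebraMap k K c)⁻¹ ∈ S := by
    rintro ⟨c, hc⟩
    obtain ⟨n, y, hy⟩ := h c hc
    have := hmem n y
    rwa [← hy, inv_mul_cancel_left₀ (pow_ne_zero _ hg')] at this
  have hli : LinearIndependent k fun c : {c : k // c ≠ 0} ↦ (⟨_, hmem' c⟩ : S) :=
    LinearIndependent.of_comp S.subtype
      ((Transcendental.linearIndependent_sub_inv hz).comp _ Subtype.val_injective)
  have hcard : Cardinal.mk {c : k // c ≠ 0} = Cardinal.mk k :=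
    Cardinal.mk_compl_of_infinite ({0} : Set k) (by
      simpa using lt_of_lt_of_le Cardinal.one_lt_aleph0 (Cardinal.infinite_iff.mp inferInstance))
  exact (hcard ▸ hli.cardinal_le_rank.trans hS).not_gt hrank

theorem rank_quotient_lt (hrank : Module.rank k R < Cardinal.mk k) (P : Ideal R) :
    Module.rank k (R ⧸ P) < Cardinal.mk k :=
  (LinearMap.rank_le_of_surjective (Ideal.Quotient.mkₐ k P).toLinearMap
    Ideal.Quotient.mk_surjective).trans_lt hrank

theorem exists_mul_pow_mem_of_mem_minimalPrimes {I Q : Ideal R} (hQ : Q ∈ I.minimalPrimes)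
    {x : R} (hx : x ∈ Q) : ∃ s ∉ Q, ∃ n : ℕ, s * x ^ n ∈ I := by
  have := hQ.1.1
  by_contra! h
  obtain ⟨p, hp, hIp, hdisj⟩ := Ideal.exists_le_prime_disjoint I
    (Q.primeCompl ⊔ Submonoid.powers x) (by
      refine Set.disjoint_left.mpr fun z hzI hz ↦ ?_
      obtain ⟨s, hs, _, ⟨n, rfl⟩, rfl⟩ := Submonoid.mem_sup.mp hz
      exact h s hs n hzI)
  have hpQ : p ≤ Q := fun z hz ↦ by
    by_contra hzQ
    exact Set.disjoint_left.mp hdisj hz (Submonoid.mem_sup_left (S := Q.primeCompl) hzQ)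
  exact Set.disjoint_left.mp hdisj (hQ.2 ⟨hp, hIp⟩ hpQ hx)
    (Submonoid.mem_sup_right (Submonoid.mem_powers x))

theorem exists_isMaximal_notMem_of_rank_lt [CharZero k]
    (hrank : Module.rank k R < Cardinal.mk k) {P : Ideal R} (hP : P.IsPrime) {f : R} (hf : f ∉ P) :
    ∃ M : Ideal R, M.IsMaximal ∧ P ≤ M ∧ f ∉ M := by
  by_contra! hM
  have hrank' : Module.rank k (R ⧸ P) < Cardinal.mk k :=
    rank_quotient_lt hrank P
  have hunit : ∀ c : k, c ≠ 0 →
      IsUnit (Ideal.Quotient.mk P f - algebraMap k (R ⧸ P) c) := by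
    intro c hc
    by_contra hu
    obtain ⟨N, hN, hfN⟩ := exists_max_ideal_of_mem_nonunits hu
    have := hM (N.comap (Ideal.Quotient.mk P))
      (Ideal.comap_isMaximal_of_surjective _ Ideal.Quotient.mk_surjective) (fun x hx ↦ by
        simp [Ideal.mem_comap, Ideal.Quotient.eq_zero_iff_mem.mpr hx])
    have hcN : algebraMap k (R ⧸ P) c ∈ N := by
      simpa using N.sub_mem (Ideal.mem_comap.mp this) hfN
    exact hN.ne_top (N.eq_top_of_isUnit_mem hcN ((isUnit_iff_ne_zero.mpr hc).map _))
  have hf0 : Ideal.Quotient.mk P f ≠ 0 := fun h ↦ hf (Ideal.Quotient.eq_zero_iff_mem.mp h)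
  have halg : IsAlgebraic k (algebraMap (R ⧸ P) (FractionRing (R ⧸ P)) (Ideal.Quotient.mk P f)) := by
    refine isAlgebraic_of_forall_pow_div_sub_mem hrank' _ 1 one_ne_zero fun c hc ↦ ?_
    obtain ⟨u, hu⟩ := hunit c hc
    refine ⟨0, (↑u⁻¹ : R ⧸ P), ?_⟩
    rw [IsScalarTower.algebraMap_apply k (R ⧸ P) (FractionRing (R ⧸ P)), ← map_sub, ← hu,
      pow_zero, one_mul]
    refine inv_eq_of_mul_eq_one_right ?_
    rw [← map_mul, Units.mul_inv, map_one]
  have halg' := (isAlgebraic_algebraMap_iff (IsFractionRing.injective (R ⧸ P) _)).mp halg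
  obtain ⟨r, hr, d, hd⟩ := halg'.exists_nonzero_dvd (mem_nonZeroDivisors_of_ne_zero hf0)
  have hfu : IsUnit (Ideal.Quotient.mk P f) :=
    isUnit_of_dvd_unit ⟨d, hd⟩ ((isUnit_iff_ne_zero.mpr hr).map (algebraMap k (R ⧸ P)))
  obtain ⟨M, hMax, hPM⟩ := P.exists_le_maximal hP.ne_top
  obtain ⟨y, hy⟩ := hfu.exists_right_inv
  obtain ⟨y, rfl⟩ := Ideal.Quotient.mk_surjective y
  rw [← map_mul, ← map_one (Ideal.Quotient.mk P), Ideal.Quotient.eq] at hy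
  have := M.sub_mem (M.mul_mem_right y (hM M hMax hPM)) (hPM hy)
  rw [sub_sub_cancel] at this
  exact hMax.ne_top (M.eq_top_iff_one.mpr this)

theorem isDeltaIdeal_of_mem_minimalPrimes [CharZero k] {Δ : Set (Derivation k R R)} {I Q : Ideal R}
    (hI : IsDeltaIdeal k R Δ I) (hQ : Q ∈ I.minimalPrimes) : IsDeltaIdeal k R Δ Q := by
  classical
  have hQp : Q.IsPrime := hQ.1.1
  intro δ hδ x hx
  by_contra hy
  have hex : ∃ n : ℕ, ∃ s ∉ Q, s * x ^ n ∈ I := by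
    obtain ⟨s, hs, n, h⟩ := exists_mul_pow_mem_of_mem_minimalPrimes hQ hx
    exact ⟨n, s, hs, h⟩
  obtain ⟨s, hs, hsx⟩ := Nat.find_spec hex
  obtain ⟨n, hn⟩ : ∃ n, Nat.find hex = n + 1 := by
    refine Nat.exists_eq_succ_of_ne_zero fun h0 ↦ hs ?_
    rw [h0, pow_zero, mul_one] at hsx
    exact hQ.1.2 hsx
  refine Nat.find_min hex (m := n) (by omega) ⟨s * s * δ x, ?_, ?_⟩
  · exact fun h ↦ (hQp.mem_or_mem h).elim (fun h ↦ hs ((or_self_iff).mp (hQp.mem_or_mem h))) hy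
  rw [hn] at hsx
  have h1 := hI δ hδ _ hsx
  have h2 : ((n : R) + 1) * (s * s * δ x * x ^ n) ∈ I := by
    have := I.sub_mem (I.mul_mem_left s h1) (I.mul_mem_left (δ s) hsx)
    rw [Derivation.leibniz, Derivation.leibniz_pow] at this
    convert this using 1
    simp only [smul_eq_mul, nsmul_eq_mul, Nat.add_sub_cancel]
    push_cast
    ring
  have hk : ((n : k) + 1) ≠ 0 := by exact_mod_cast n.succ_ne_zero
  have h3 := I.mul_mem_left (algebraMap k R ((n : k) + 1)⁻¹) h2
  have h4 : algebraMap k R ((n : k) + 1)⁻¹ * ((n : R) + 1) = 1 := by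
    have := congrArg (algebraMap k R) (inv_mul_cancel₀ hk)
    simpa using this
  rwa [← mul_assoc, h4, one_mul] at h3

theorem isDeltaIdeal_deltaCore (Δ : Set (Derivation k R R)) (J : Ideal R) :
    IsDeltaIdeal k R Δ (deltaCore k R Δ J) := by
  intro δ hδ x hx
  rw [deltaCore, sSup_eq_iSup'] at hx
  refine Submodule.iSup_induction _ (motive := fun x ↦ δ x ∈ deltaCore k R Δ J) hx
    (fun I x hx ↦ ?_) (by simp) (fun x y hx hy ↦ ?_)
  · exact (le_sSup I.2 : (I : Ideal R) ≤ deltaCore k R Δ J) (I.2.1 δ hδ x hx)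
  · rw [map_add]
    exact Ideal.add_mem _ hx hy

theorem deltaCore_le (Δ : Set (Derivation k R R)) (J : Ideal R) : deltaCore k R Δ J ≤ J :=
  sSup_le fun _ hI ↦ hI.2

theorem le_deltaCore {Δ : Set (Derivation k R R)} {I J : Ideal R} (hI : IsDeltaIdeal k R Δ I)
    (hIJ : I ≤ J) : I ≤ deltaCore k R Δ J :=
  le_sSup ⟨hI, hIJ⟩

theorem isDeltaPrime_deltaCore [CharZero k] (Δ : Set (Derivation k R R)) {J : Ideal R}
    (hJ : J.IsPrime) : IsDeltaPrime k R Δ (deltaCore k R Δ J) := by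
  obtain ⟨Q, hQ, hQJ⟩ := Ideal.exists_minimalPrimes_le (deltaCore_le Δ J)
  have := le_antisymm (le_deltaCore (isDeltaIdeal_of_mem_minimalPrimes
    (isDeltaIdeal_deltaCore Δ J) hQ) hQJ) hQ.1.2
  exact ⟨this ▸ hQ.1.1, isDeltaIdeal_deltaCore Δ J⟩

/-- The ideal of elements of `R` whose class modulo `P` becomes, after inverting `b`, a multiple
of the class of `a`. -/
def saturatedSpan (P : Ideal R) (a b : R) : Ideal R where
  carrier := {x | ∃ (n : ℕ) (y : R), b ^ n * x - a * y ∈ P}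
  zero_mem' := ⟨0, 0, by simp⟩
  add_mem' := by
    rintro x x' ⟨n, y, h⟩ ⟨n', y', h'⟩
    refine ⟨n + n', b ^ n' * y + b ^ n * y', ?_⟩
    convert P.add_mem (P.mul_mem_left (b ^ n') h) (P.mul_mem_left (b ^ n) h') using 1
    ring
  smul_mem' := by
    rintro r x ⟨n, y, h⟩
    refine ⟨n, r * y, ?_⟩
    convert P.mul_mem_left r h using 1
    rw [smul_eq_mul]
    ring

theorem le_saturatedSpan (P : Ideal R) (a b : R) : P ≤ saturatedSpan P a b :=
  fun x hx ↦ ⟨0, 0, by simpa using hx⟩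

theorem self_mem_saturatedSpan (P : Ideal R) (a b : R) : a ∈ saturatedSpan P a b :=
  ⟨0, 1, by simp⟩

theorem isDeltaIdeal_saturatedSpan {Δ : Set (Derivation k R R)} {P : Ideal R}
    (hP : IsDeltaIdeal k R Δ P) {a b : R} (h : ∀ δ ∈ Δ, δ a * b - a * δ b ∈ P) :
    IsDeltaIdeal k R Δ (saturatedSpan P a b) := by
  rintro δ hδ x ⟨n, y, hx⟩
  refine ⟨n + 1, δ b * y + b * δ y - (n : R) * δ b * y, ?_⟩
  have h1 := hP δ hδ _ hx
  have h2 : b * ((n : R) * b ^ (n - 1)) = (n : R) * b ^ n := by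
    cases n with
    | zero => simp
    | succ n => simp only [Nat.add_sub_cancel]; ring
  have h3 := P.sub_mem (P.add_mem (P.mul_mem_left b h1) (P.mul_mem_left y (h δ hδ)))
    (P.mul_mem_left ((n : R) * δ b) hx)
  convert h3 using 1
  rw [map_sub, Derivation.leibniz, Derivation.leibniz, Derivation.leibniz_pow]
  simp only [smul_eq_mul, nsmul_eq_mul]
  linear_combination (- x * δ b) * h2

/-- An element outside `P` that lies in every `Δ`-prime ideal properly containing `P`
forces `P` to be `Δ`-rational. -/
theorem isDeltaRational_of_forall_mem [CharZero k] (hrank : Module.rank k R < Cardinal.mk k)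
    {Δ : Set (Derivation k R R)} {P : Ideal R} (hP : IsDeltaPrime k R Δ P) {f : R} (hf : f ∉ P)
    (hfQ : ∀ Q : Ideal R, IsDeltaPrime k R Δ Q → P < Q → f ∈ Q) :
    IsDeltaRational k R Δ P hP.1 := by
  have := hP.1
  intro a b hb hab
  let φ : R →+* (FractionRing (R ⧸ P)) := (algebraMap (R ⧸ P) (FractionRing (R ⧸ P))).comp (Ideal.Quotient.mk P)
  have hφ0 : ∀ x, φ x = 0 ↔ x ∈ P := fun x ↦ by
    simp [φ, Ideal.Quotient.eq_zero_iff_mem]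
  have hφk : ∀ c : k, φ (algebraMap k R c) = algebraMap k (FractionRing (R ⧸ P)) c := fun c ↦
    (IsScalarTower.algebraMap_apply k (R ⧸ P) (FractionRing (R ⧸ P)) c).symm
  have hφb : φ b ≠ 0 := (hφ0 b).not.mpr hb
  have hφf : φ f ≠ 0 := (hφ0 f).not.mpr hf
  change IsAlgebraic k (φ a / φ b)
  by_cases hex : ∃ c : k, a - algebraMap k R c * b ∈ P
  · obtain ⟨c, hc⟩ := hex
    have : φ a / φ b = algebraMap k (FractionRing (R ⧸ P)) c := by
      rw [div_eq_iff hφb, ← hφk, ← map_mul, ← sub_eq_zero, ← map_sub, hφ0]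
      exact hc
    rw [this]
    exact isAlgebraic_algebraMap c
  push Not at hex
  refine isAlgebraic_of_forall_pow_div_sub_mem (D := R ⧸ P) (rank_quotient_lt hrank P) _
    (Ideal.Quotient.mk P (b * f)) ?_ fun c _ ↦ ?_
  · rw [Ne, Ideal.Quotient.eq_zero_iff_mem]
    exact hP.1.mul_notMem hb hf
  set a' := a - algebraMap k R c * b with ha'
  have hφa' : φ a' ≠ 0 := (hφ0 a').not.mpr (hex c)
  have hab' : ∀ δ ∈ Δ, δ a' * b - a' * δ b ∈ P := by
    intro δ hδ
    convert hab δ hδ using 1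
    rw [ha', map_sub, Derivation.leibniz, Derivation.map_algebraMap]
    simp only [smul_eq_mul]
    ring
  have hrad : f ∈ (saturatedSpan P a' b).radical := by
    rw [← Ideal.sInf_minimalPrimes, Submodule.mem_sInf]
    intro Q hQ
    refine hfQ Q ⟨hQ.1.1, isDeltaIdeal_of_mem_minimalPrimes
      (isDeltaIdeal_saturatedSpan hP.2 hab') hQ⟩ (lt_of_le_of_ne ?_ ?_)
    · exact (le_saturatedSpan P a' b).trans hQ.1.2
    · rintro rfl
      exact hex c (hQ.1.2 (self_mem_saturatedSpan P a' b))
  obtain ⟨m, n, y, hy⟩ := hrad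
  have hy' : φ b ^ n * φ f ^ m = φ a' * φ y := by
    rw [← map_pow, ← map_pow, ← map_mul, ← map_mul, ← sub_eq_zero, ← map_sub, hφ0]
    exact hy
  refine ⟨n + m, Ideal.Quotient.mk P (b * (b ^ m * f ^ n * y)), ?_⟩
  change φ (b * f) ^ (n + m) * _ = φ _
  have hsub : φ a / φ b - algebraMap k (FractionRing (R ⧸ P)) c = φ a' / φ b := by
    rw [ha', map_sub, map_mul, hφk]
    field_simp
  rw [hsub, inv_div]
  simp only [map_mul, map_pow]
  field_simp
  linear_combination (φ b ^ m * φ f ^ n) * hy'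

theorem exists_notMem_forall_mem_of_separable {Δ : Set (Derivation k R R)} {P : Ideal R}
    (hP : P.IsPrime) (h : DeltaSeparable k R Δ Cardinal.aleph0 P) :
    ∃ f ∉ P, ∀ Q : Ideal R, IsDeltaPrime k R Δ Q → P < Q → f ∈ Q := by
  obtain ⟨Λ, hΛ, hcard, hQ⟩ := h
  have hfin : Λ.Finite := Cardinal.lt_aleph0_iff_set_finite.mp hcard
  have hle : ¬ hfin.toFinset.inf id ≤ P := by
    rw [hP.inf_le']
    rintro ⟨Q, hQΛ, hQP⟩
    exact (hΛ Q (hfin.mem_toFinset.mp hQΛ)).2.not_ge hQP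
  obtain ⟨f, hf, hfP⟩ := SetLike.not_le_iff_exists.mp hle
  refine ⟨f, hfP, fun Q hQp hPQ ↦ ?_⟩
  obtain ⟨Q', hQ', hle'⟩ := hQ Q hQp hPQ
  exact hle' ((Finset.inf_le (f := id) (hfin.mem_toFinset.mpr hQ') : _ ≤ Q') hf)

theorem isLocallyClosed_singleton {Δ : Set (Derivation k R R)} {P : PrimeSpectrum R}
    (hP : IsDeltaIdeal k R Δ P.asIdeal) {f : R} (hf : f ∉ P.asIdeal)
    (hfQ : ∀ Q : Ideal R, IsDeltaPrime k R Δ Q → P.asIdeal < Q → f ∈ Q) :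
    IsLocallyClosed ({⟨P, hP⟩} : Set (DeltaSpec k R Δ)) := by
  refine ⟨Subtype.val ⁻¹' (PrimeSpectrum.basicOpen f : Set (PrimeSpectrum R)),
    Subtype.val ⁻¹' PrimeSpectrum.zeroLocus (P.asIdeal : Set R),
    (PrimeSpectrum.isOpen_basicOpen).preimage continuous_subtype_val,
    (PrimeSpectrum.isClosed_zeroLocus _).preimage continuous_subtype_val, ?_⟩
  ext ⟨Q, hQ⟩
  simp only [Set.mem_singleton_iff, Subtype.mk.injEq, Set.mem_inter_iff, Set.mem_preimage,
    SetLike.mem_coe, PrimeSpectrum.mem_basicOpen, PrimeSpectrum.mem_zeroLocus,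
    SetLike.coe_subset_coe]
  constructor
  · rintro rfl
    exact ⟨hf, le_rfl⟩
  · rintro ⟨hfQ', hPQ⟩
    by_contra hne
    exact hfQ' (hfQ Q.asIdeal ⟨Q.isPrime, hQ⟩
      (lt_of_le_of_ne hPQ fun h ↦ hne (PrimeSpectrum.ext h.symm)))

theorem isDeltaPrimitive_of_forall_mem [CharZero k] (hrank : Module.rank k R < Cardinal.mk k)
    {Δ : Set (Derivation k R R)} {P : Ideal R} (hP : IsDeltaPrime k R Δ P) {f : R} (hf : f ∉ P)
    (hfQ : ∀ Q : Ideal R, IsDeltaPrime k R Δ Q → P < Q → f ∈ Q) :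
    IsDeltaPrimitive k R Δ P := by
  obtain ⟨M, hM, hPM, hfM⟩ := exists_isMaximal_notMem_of_rank_lt hrank hP.1 hf
  refine ⟨M, hM, ?_⟩
  by_contra hne
  exact hfM (deltaCore_le Δ M (hfQ _ (isDeltaPrime_deltaCore Δ hM.isPrime)
    (lt_of_le_of_ne (le_deltaCore hP.2 hPM) (Ne.symm hne))))

theorem deltaDME_of_forall_separable [CharZero k] (hrank : Module.rank k R < Cardinal.mk k)
    {Δ : Set (Derivation k R R)}
    (h : ∀ P : Ideal R, IsDeltaPrime k R Δ P → DeltaSeparable k R Δ Cardinal.aleph0 P) :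
    DeltaDME k R Δ := by
  intro P hP
  have hP' : IsDeltaPrime k R Δ P.asIdeal := ⟨P.isPrime, hP⟩
  obtain ⟨f, hf, hfQ⟩ := exists_notMem_forall_mem_of_separable hP'.1 (h _ hP')
  have hprim := isDeltaPrimitive_of_forall_mem hrank hP' hf hfQ
  exact ⟨iff_of_true (isLocallyClosed_singleton hP hf hfQ) hprim,
    iff_of_true hprim (isDeltaRational_of_forall_mem hrank hP' hf hfQ)⟩

theorem isDeltaPrimitive_of_finite [CharZero k] (hrank : Module.rank k R < Cardinal.mk k)
    {Δ : Set (Derivation k R R)} (hfin : {P : Ideal R | IsDeltaPrimitive k R Δ P}.Finite)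
    {P : Ideal R} (hP : IsDeltaPrime k R Δ P) : IsDeltaPrimitive k R Δ P := by
  classical
  let F := {Q ∈ hfin.toFinset | P ≤ Q}
  have hle : F.inf id ≤ P := by
    intro f hf
    by_contra hfP
    obtain ⟨M, hM, hPM, hfM⟩ := exists_isMaximal_notMem_of_rank_lt hrank hP.1 hfP
    have hmem : deltaCore k R Δ M ∈ F := by
      simp only [F, Finset.mem_filter, hfin.mem_toFinset]
      exact ⟨⟨M, hM, rfl⟩, le_deltaCore hP.2 hPM⟩
    exact hfM (deltaCore_le Δ M ((Finset.inf_le (f := id) hmem : _ ≤ deltaCore k R Δ M) hf))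
  obtain ⟨Q, hQF, hQP⟩ := hP.1.inf_le'.mp hle
  obtain ⟨hQ, hPQ⟩ := Finset.mem_filter.mp hQF
  exact le_antisymm hPQ hQP ▸ hfin.mem_toFinset.mp hQ

end DifferentialAlgebra

/-- If every point of `Δ`-spec `R` is `ℵ₀`-separable then `R` satisfies the `Δ`-Dixmier–Moeglin
equivalence; in particular this holds when there are only finitely many `Δ`-primitive ideals. -/
theorem deltaDME_of_aleph0_separable (k R : Type u) [Field k] [CharZero k] [CommRing R]
    [Algebra k R] [IsNoetherianRing R]
    (hrank : Module.rank k R < Cardinal.mk k)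
    (Δ : Set (Derivation k R R)) (hΔ : Cardinal.mk Δ < Cardinal.mk k) :
    ((∀ P : Ideal R, IsDeltaPrime k R Δ P → DeltaSeparable k R Δ Cardinal.aleph0 P) →
      DeltaDME k R Δ) ∧
    ({P : Ideal R | IsDeltaPrimitive k R Δ P}.Finite → DeltaDME k R Δ) := by
  refine ⟨DifferentialAlgebra.deltaDME_of_forall_separable hrank, fun hfin ↦
    DifferentialAlgebra.deltaDME_of_forall_separable hrank fun P _ ↦ ?_⟩
  refine ⟨{Q | IsDeltaPrime k R Δ Q ∧ P < Q}, fun Q hQ ↦ hQ, ?_,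
    fun Q hQ hPQ ↦ ⟨Q, ⟨hQ, hPQ⟩, le_rfl⟩⟩
  exact Cardinal.lt_aleph0_iff_set_finite.mpr
    (hfin.subset fun Q hQ ↦ DifferentialAlgebra.isDeltaPrimitive_of_finite hrank hfin hQ.1)
end
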